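/- arXiv:1403.6933 — 2 statements merged into one kernel-verified Lean document; each statement's English description precedes it below -/
import Mathlib

section
/- If n ≥ 3, 1 ≤ m ≤ n−1, and r ≥ 1, then a_{n,m,r,0} = Σ_{j=0}^{r} a_{n−1,m,r,j}. -/
/-- The number of ascents of a word of nonnegative integers. -/
def numAscents (w : List ℕ) : ℕ :=
  (w.zip w.tail).countP (fun p => p.1 < p.2)

/-- A word of nonnegative integers is an ascent sequence if it starts with 0 and
each subsequent entry is at most one more than the number of ascents preceding it. -/
def IsAscentSeq (w : List ℕ) : Prop :=
  w.head? = some 0 ∧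
    ∀ i (h : i < w.length), 1 ≤ i → w.get ⟨i, h⟩ ≤ numAscents (w.take i) + 1

/-- A word `π` contains the pattern `τ` if it has a subsequence order-isomorphic to `τ`. -/
def Contains (π τ : List ℕ) : Prop :=
  ∃ f : Fin τ.length → Fin π.length, StrictMono f ∧
    ∀ i j, (π.get (f i) < π.get (f j) ↔ τ.get i < τ.get j) ∧
      (π.get (f i) > π.get (f j) ↔ τ.get i > τ.get j)

/-- A word avoids a pattern if it does not contain it. -/
def Avoids (π τ : List ℕ) : Prop := ¬ Contains π τ

/-- `a_{n,m,r,s}`: the number of ascent sequences of length `n` avoiding the pattern 021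
with exactly `m` ascents, largest letter `r`, and last letter `s`. -/
noncomputable def aCount (n m r s : ℕ) : ℕ :=
  {w : List ℕ | w.length = n ∧ IsAscentSeq w ∧ Avoids w [0,2,1] ∧
    numAscents w = m ∧ w.foldr max 0 = r ∧ w.getLast? = some s}.ncard

/-- Appending a letter `0` creates no ascent. -/
theorem numAscents_concat_zero (w : List ℕ) : numAscents (w ++ [0]) = numAscents w := by
  unfold numAscents
  induction w with
  | nil => rfl
  | cons a t ih =>
    cases t with
    | nil => simp
    | cons b t =>
      simp only [List.cons_append, List.tail_cons, List.zip_cons_cons, List.countP_cons] at ih ⊢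
      rw [ih]

theorem isAscentSeq_concat_zero_iff {w : List ℕ} (hw : w ≠ []) :
    IsAscentSeq (w ++ [0]) ↔ IsAscentSeq w := by
  unfold IsAscentSeq
  refine and_congr (by rw [List.head?_append_of_ne_nil _ hw]) ⟨fun h i hi h1 => ?_, fun h i hi h1 => ?_⟩
  · have := h i (by simp; omega) h1
    rw [List.take_append_of_le_length hi.le] at this
    simpa [List.getElem_append_left hi] using this
  · by_cases hi' : i < w.length
    · rw [List.take_append_of_le_length hi'.le]
      simpa [List.getElem_append_left hi'] using h i hi' h1
    · simp [List.getElem_append_right (not_lt.mp hi')]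

theorem contains_zero_two_one_iff (w : List ℕ) :
    Contains w [0, 2, 1] ↔
      ∃ i j k : Fin w.length, i < j ∧ j < k ∧ w.get i < w.get k ∧ w.get k < w.get j := by
  constructor
  · rintro ⟨f, hf, h⟩
    exact ⟨f 0, f 1, f 2, hf (by decide), hf (by decide), (h 0 2).1.2 (by simp),
      (h 2 1).1.2 (by simp)⟩
  · rintro ⟨i, j, k, hij, hjk, hik, hkj⟩
    refine ⟨![i, j, k], ?_, ?_⟩
    · rw [Fin.strictMono_iff_lt_succ]
      intro a
      fin_cases a
      · exact hij
      · exact hjk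
    · intro a b
      fin_cases a <;> fin_cases b <;> simp at hik hkj ⊢ <;> omega

theorem avoids_concat_zero_iff (w : List ℕ) :
    Avoids (w ++ [0]) [0, 2, 1] ↔ Avoids w [0, 2, 1] := by
  unfold Avoids
  rw [not_iff_not, contains_zero_two_one_iff, contains_zero_two_one_iff]
  constructor
  · rintro ⟨⟨i, hi⟩, ⟨j, hj⟩, ⟨k, hk⟩, hij, hjk, hik, hkj⟩
    simp only [Fin.mk_lt_mk, List.get_eq_getElem] at hij hjk hik hkj
    have hk' : k < w.length := by
      by_contra hk'
      simp [List.getElem_append_right (not_lt.mp hk')] at hik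
    rw [List.getElem_append_left hk', List.getElem_append_left (by omega)] at hik hkj
    exact ⟨⟨i, by omega⟩, ⟨j, by omega⟩, ⟨k, hk'⟩, hij, hjk, hik, hkj⟩
  · rintro ⟨⟨i, hi⟩, ⟨j, hj⟩, ⟨k, hk⟩, hij, hjk, hik, hkj⟩
    have hl : (w ++ [0]).length = w.length + 1 := by simp
    refine ⟨⟨i, by omega⟩, ⟨j, by omega⟩, ⟨k, by omega⟩, hij, hjk, ?_, ?_⟩
    · simpa [List.getElem_append_left hi, List.getElem_append_left hk] using hik
    · simpa [List.getElem_append_left hj, List.getElem_append_left hk] using hkj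

theorem foldr_max_concat_zero (w : List ℕ) : (w ++ [0]).foldr max 0 = w.foldr max 0 := by
  simp

theorem le_foldr_max {w : List ℕ} {x : ℕ} (hx : x ∈ w) : x ≤ w.foldr max 0 := by
  induction w with
  | nil => simp at hx
  | cons a t ih =>
    rcases List.mem_cons.mp hx with rfl | h
    · exact le_max_left _ _
    · exact (ih h).trans (le_max_right _ _)

theorem finite_length_eq_foldr_max_eq (n r : ℕ) :
    {w : List ℕ | w.length = n ∧ w.foldr max 0 = r}.Finite := by
  refine ((List.finite_length_eq (Fin (r + 1)) n).image (List.map Fin.val)).subset ?_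
  rintro w ⟨hn, hr⟩
  refine ⟨w.map (Fin.ofNat (r + 1)), by simpa using hn, ?_⟩
  rw [List.map_map]
  refine (List.map_congr_left fun x hx => ?_).trans (List.map_id w)
  exact Nat.mod_eq_of_lt (Nat.lt_succ_of_le (hr ▸ le_foldr_max hx))

/-- The words counted by `aCount n m r s`, for arbitrary last letter `s`. -/
def ascentWords (n m r : ℕ) : Set (List ℕ) :=
  {w | w.length = n ∧ IsAscentSeq w ∧ Avoids w [0, 2, 1] ∧ numAscents w = m ∧ w.foldr max 0 = r}

theorem finite_ascentWords (n m r : ℕ) : (ascentWords n m r).Finite :=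
  (finite_length_eq_foldr_max_eq n r).subset fun _ h => ⟨h.1, h.2.2.2.2⟩

theorem concat_zero_mem_ascentWords_iff {n m r : ℕ} {w : List ℕ} (hn : n ≠ 0) :
    w ++ [0] ∈ ascentWords (n + 1) m r ↔ w ∈ ascentWords n m r := by
  simp only [ascentWords, Set.mem_ofPred_eq, List.length_append, List.length_singleton,
    Nat.add_right_cancel_iff, numAscents_concat_zero, avoids_concat_zero_iff,
    foldr_max_concat_zero]
  refine and_congr_right fun h => ?_
  rw [isAscentSeq_concat_zero_iff (by rintro rfl; exact hn h.symm)]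

theorem aCount_eq_ncard (n m r s : ℕ) :
    aCount n m r s = {w ∈ ascentWords n m r | w.getLast? = some s}.ncard := by
  simp only [aCount, ascentWords, Set.mem_ofPred_eq, and_assoc]

theorem aCount_succ_zero {n : ℕ} (m r : ℕ) (hn : n ≠ 0) :
    aCount (n + 1) m r 0 = (ascentWords n m r).ncard := by
  rw [aCount_eq_ncard, ← Set.ncard_image_of_injective (ascentWords n m r) (List.append_left_injective [0])]
  congr 1
  ext w
  simp only [Set.mem_ofPred_eq, Set.mem_image]
  constructor
  · rintro ⟨hw, hl⟩
    obtain ⟨v, rfl⟩ := List.getLast?_eq_some_iff.mp hl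
    exact ⟨v, (concat_zero_mem_ascentWords_iff hn).mp hw, rfl⟩
  · rintro ⟨v, hv, rfl⟩
    exact ⟨(concat_zero_mem_ascentWords_iff hn).mpr hv, by simp⟩

theorem ncard_ascentWords_eq_sum {n : ℕ} (m r : ℕ) (hn : n ≠ 0) :
    (ascentWords n m r).ncard = ∑ j ∈ Finset.range (r + 1), aCount n m r j := by
  have hfin := finite_ascentWords n m r
  have hlast : ∀ w ∈ ascentWords n m r, ∃ h : w ≠ [], w.getLast h < r + 1 := by
    rintro w ⟨hl, -, -, -, hr⟩
    have h : w ≠ [] := by rintro rfl; exact hn hl.symm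
    exact ⟨h, Nat.lt_succ_of_le (hr ▸ le_foldr_max (List.getLast_mem h))⟩
  rw [Set.ncard_eq_toFinset_card _ hfin,
    Finset.card_eq_sum_card_fiberwise (f := fun w => w.getLastD 0) (t := Finset.range (r + 1))]
  · refine Finset.sum_congr rfl fun j _ => ?_
    rw [aCount_eq_ncard, ← Set.ncard_coe_finset]
    congr 1
    ext w
    simp only [Finset.coe_filter, Set.Finite.mem_toFinset, Set.mem_ofPred_eq]
    refine and_congr_right fun hw => ?_
    obtain ⟨h, -⟩ := hlast w hw
    simp [List.getLastD_eq_getLast?, List.getLast?_eq_some_getLast h]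
  · intro w hw
    obtain ⟨h, hlt⟩ := hlast w (by simpa using hw)
    simpa [List.getLastD_eq_getLast?, List.getLast?_eq_some_getLast h] using hlt

/-- Recurrence `a_{n,m,r,0} = Σ_{j=0}^{r} a_{n-1,m,r,j}` for `n ≥ 3`, `1 ≤ m ≤ n-1`, `r ≥ 1`. -/
theorem aCount_rec_last_zero (n m r : ℕ) (hn : 3 ≤ n) (hm1 : 1 ≤ m) (hm2 : m ≤ n - 1)
    (hr : 1 ≤ r) :
    aCount n m r 0 = ∑ j ∈ Finset.range (r + 1), aCount (n - 1) m r j := by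
  obtain ⟨k, rfl⟩ : ∃ k, n = k + 1 := ⟨n - 1, by omega⟩
  rw [Nat.add_sub_cancel, aCount_succ_zero m r (by omega), ncard_ascentWords_eq_sum m r (by omega)]
end

section
/- Let n ≥ 3 and 2 ≤ m ≤ n−1. Then for all rational numbers u, v: (i) if uv ≠ 1, then A_{n,m}(u,v) = B_{n−1,m}(uv) + A_{n−1,m}(1,v) + A_{n−2,m−1}(1,uv) + (uv/(1−uv))·(A_{n−1,m−1}(1,uv) − (uv)^m·A_{n−1,m−1}(1,1)); and (ii) if v ≠ 1, then B_{n,m}(v) = B_{n−1,m}(v) + A_{n−2,m−1}(1,v) + (v/(1−v))·(A_{n−1,m−1}(1,v) − v^m·A_{n−1,m−1}(1,1)). -/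
/-- The polynomial `A_{n,m}(u,v) = Σ_{r=0}^{m} Σ_{s=0}^{r} a_{n,m,r,s} u^s v^r`. -/
noncomputable def Apoly (n m : ℕ) (u v : ℚ) : ℚ :=
  ∑ r ∈ Finset.range (m + 1), (∑ s ∈ Finset.range (r + 1), (aCount n m r s : ℚ) * u ^ s) * v ^ r

/-- The polynomial `B_{n,m}(v) = Σ_{r=0}^{m} a_{n,m,r,r} v^r`. -/
noncomputable def Bpoly (n m : ℕ) (v : ℚ) : ℚ :=
  ∑ r ∈ Finset.range (m + 1), (aCount n m r r : ℚ) * v ^ r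

theorem numAscents_cons_cons (a b : ℕ) (l : List ℕ) :
    numAscents (a :: b :: l) = numAscents (b :: l) + if a < b then 1 else 0 := by
  simp [numAscents, List.countP_cons]

theorem numAscents_append_singleton {w : List ℕ} (hw : w ≠ []) (s : ℕ) :
    numAscents (w ++ [s]) = numAscents w + if w.getLastD 0 < s then 1 else 0 := by
  induction w with
  | nil => exact absurd rfl hw
  | cons a l ih =>
    cases l with
    | nil => simp [numAscents, List.countP_cons]
    | cons b l =>
      have h := ih (by simp)
      simp only [List.cons_append, numAscents_cons_cons] at h ⊢
      rw [h]
      simp only [List.getLastD_cons]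
      omega

theorem foldr_max_append_singleton (w : List ℕ) (s : ℕ) :
    (w ++ [s]).foldr max 0 = max (w.foldr max 0) s := by
  induction w with
  | nil => simp
  | cons a l ih => simp only [List.cons_append, List.foldr_cons, ih, max_assoc]

theorem foldr_max_le_iff (w : List ℕ) (s : ℕ) : w.foldr max 0 ≤ s ↔ ∀ a ∈ w, a ≤ s := by
  induction w with
  | nil => simp
  | cons a l ih => simp [ih]

theorem isAscentSeq_append_singleton {w : List ℕ} (hw : w ≠ []) (s : ℕ) :
    IsAscentSeq (w ++ [s]) ↔ IsAscentSeq w ∧ s ≤ numAscents w + 1 := by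
  have hpos : 0 < w.length := List.length_pos_iff.2 hw
  simp only [IsAscentSeq, List.head?_append_of_ne_nil w hw, List.get_eq_getElem, and_assoc]
  refine and_congr_right fun _ => ⟨fun h => ⟨fun i hi h1 => ?_, ?_⟩, fun h i hi h1 => ?_⟩
  · have := h i (by simp; omega) h1
    rwa [List.getElem_append_left hi, List.take_append_of_le_length hi.le] at this
  · have := h w.length (by simp) hpos
    simpa using this
  · rcases lt_or_ge i w.length with hi' | hi'
    · rw [List.getElem_append_left hi', List.take_append_of_le_length hi'.le]
      exact h.1 i hi' h1
    · obtain rfl : i = w.length := by simp at hi; omega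
      simpa using h.2

theorem avoids_iff_pairwise {w : List ℕ} (hw : w.head? = some 0) :
    Avoids w [0, 2, 1] ↔ w.Pairwise fun a b => b = 0 ∨ a ≤ b := by
  rw [List.pairwise_iff_getElem]
  constructor
  · intro h i j hi hj hij
    by_contra! hc
    have hlen : 0 < w.length := by omega
    have h0 : w[0] = 0 := by
      rw [List.head?_eq_getElem?, List.getElem?_eq_getElem hlen] at hw
      simpa using hw
    have hi0 : 0 < i := by
      rcases Nat.eq_zero_or_pos i with rfl | h'
      · omega
      · exact h'
    refine h ⟨![⟨0, hlen⟩, ⟨i, hi⟩, ⟨j, hj⟩], ?_, ?_⟩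
    · intro a b hab
      fin_cases a <;> fin_cases b <;> simp_all; omega
    · intro a b
      fin_cases a <;> fin_cases b <;> simp [h0] <;> omega
  · rintro h ⟨f, hf, hp⟩
    have h12 : f (1 : Fin 3) < f (2 : Fin 3) := hf (by decide)
    have h1 := (hp (2 : Fin 3) (1 : Fin 3)).1.2 (by decide)
    have h2 := (hp (0 : Fin 3) (2 : Fin 3)).1.2 (by decide)
    have := h _ _ (f (1 : Fin 3)).2 (f (2 : Fin 3)).2 h12
    simp only [List.get_eq_getElem] at h1 h2
    omega

/-- The letters that extend a 021-avoiding ascent sequence to another one. -/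
def extensions (w : List ℕ) : Finset ℕ :=
  (Finset.range (numAscents w + 2)).filter fun s => s = 0 ∨ w.foldr max 0 ≤ s

theorem mem_extensions {w : List ℕ} {s : ℕ} :
    s ∈ extensions w ↔ s ≤ numAscents w + 1 ∧ (s = 0 ∨ w.foldr max 0 ≤ s) := by
  simp [extensions, Nat.lt_succ_iff]

/-- The 021-avoiding ascent sequences of length `n + 1`. -/
def avoiders : ℕ → Finset (List ℕ)
  | 0 => {[0]}
  | n + 1 => (avoiders n).biUnion fun w => (extensions w).image fun s => w ++ [s]

theorem append_singleton_isAscentSeq_avoids_iff {w : List ℕ} (hw : w ≠ []) (s : ℕ) :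
    (IsAscentSeq (w ++ [s]) ∧ Avoids (w ++ [s]) [0, 2, 1]) ↔
      (IsAscentSeq w ∧ Avoids w [0, 2, 1]) ∧ s ∈ extensions w := by
  rw [isAscentSeq_append_singleton hw, mem_extensions]
  by_cases h : IsAscentSeq w
  · rw [avoids_iff_pairwise h.1,
      avoids_iff_pairwise (by rw [List.head?_append_of_ne_nil w hw]; exact h.1),
      List.pairwise_append, foldr_max_le_iff]
    have : (∀ a ∈ w, ∀ b ∈ [s], b = 0 ∨ a ≤ b) ↔ (s = 0 ∨ ∀ a ∈ w, a ≤ s) := by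
      simp only [List.mem_singleton, forall_eq]
      by_cases hs : s = 0 <;> simp [hs]
    rw [this]
    simp only [List.pairwise_singleton]
    tauto
  · tauto

theorem mem_avoiders {n : ℕ} {w : List ℕ} :
    w ∈ avoiders n ↔ w.length = n + 1 ∧ IsAscentSeq w ∧ Avoids w [0, 2, 1] := by
  induction n generalizing w with
  | zero =>
    simp only [avoiders, Finset.mem_singleton]
    constructor
    · rintro rfl
      refine ⟨rfl, ⟨rfl, fun i h h1 => ?_⟩, ?_⟩
      · simp at h; omega
      · rw [avoids_iff_pairwise rfl]; simp
    · rintro ⟨h, h', -⟩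
      obtain ⟨a, rfl⟩ := List.length_eq_one_iff.1 h
      simpa using h'.1
  | succ n ih =>
    simp only [avoiders, Finset.mem_biUnion, Finset.mem_image]
    constructor
    · rintro ⟨x, hx, s, hs, rfl⟩
      obtain ⟨hl, hx⟩ := ih.1 hx
      have hne : x ≠ [] := by rintro rfl; simp at hl
      exact ⟨by simp [hl], (append_singleton_isAscentSeq_avoids_iff hne s).2 ⟨hx, hs⟩⟩
    · rintro ⟨hl, hw⟩
      obtain rfl | ⟨x, s, rfl⟩ := List.eq_nil_or_concat' w
      · simp at hl
      have hl' : x.length = n + 1 := by simpa using hl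
      have hne : x ≠ [] := by rintro rfl; simp at hl'
      obtain ⟨hx, hs⟩ := (append_singleton_isAscentSeq_avoids_iff hne s).1 hw
      exact ⟨x, ih.2 ⟨hl', hx⟩, s, hs, rfl⟩

theorem ne_nil_of_mem_avoiders {n : ℕ} {w : List ℕ} (hw : w ∈ avoiders n) : w ≠ [] := by
  rintro rfl
  simpa using (mem_avoiders.1 hw).1

theorem sum_avoiders_succ (n : ℕ) (f : List ℕ → ℚ) :
    ∑ w ∈ avoiders (n + 1), f w = ∑ w ∈ avoiders n, ∑ s ∈ extensions w, f (w ++ [s]) := by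
  rw [avoiders, Finset.sum_biUnion]
  · refine Finset.sum_congr rfl fun w _ => Finset.sum_image fun s _ t _ h => ?_
    simpa using h
  · intro x _ y _ hxy
    refine Finset.disjoint_left.2 fun z hz hz' => hxy ?_
    obtain ⟨s, -, rfl⟩ := Finset.mem_image.1 hz
    obtain ⟨t, -, h⟩ := Finset.mem_image.1 hz'
    exact (List.append_inj_left' h rfl).symm

theorem avoiders_invariants {n : ℕ} {w : List ℕ} (hw : w ∈ avoiders n) :
    (w.getLastD 0 = 0 ∨ w.getLastD 0 = w.foldr max 0) ∧ w.foldr max 0 ≤ numAscents w ∧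
      (w.foldr max 0 = 0 → numAscents w = 0) := by
  induction n generalizing w with
  | zero =>
    obtain rfl : w = [0] := by simpa [avoiders] using hw
    simp [numAscents]
  | succ n ih =>
    simp only [avoiders, Finset.mem_biUnion, Finset.mem_image] at hw
    obtain ⟨x, hx, s, hs, rfl⟩ := hw
    obtain ⟨h1, h2, h3⟩ := ih hx
    rw [mem_extensions] at hs
    rw [numAscents_append_singleton (ne_nil_of_mem_avoiders hx), foldr_max_append_singleton]
    have hl : (x ++ [s]).getLastD 0 = s := by simp
    rw [hl]
    refine ⟨by omega, ?_, ?_⟩ <;> split_ifs <;> omega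

theorem aCount_eq_sum (n m r s : ℕ) :
    (aCount (n + 1) m r s : ℚ) = ∑ w ∈ avoiders n,
      if numAscents w = m ∧ w.foldr max 0 = r ∧ w.getLastD 0 = s then 1 else 0 := by
  rw [Finset.sum_boole, aCount, ← Set.ncard_coe_finset]
  congr 2
  ext w
  simp only [Set.mem_ofPred_eq, Finset.coe_filter, mem_avoiders, and_assoc]
  refine and_congr_right fun hl => ?_
  have hne : w ≠ [] := by rintro rfl; simp at hl
  rw [List.getLastD_eq_getLast?, List.getLast?_eq_getLast_of_ne_nil hne]
  simp

theorem Apoly_eq_sum (n m : ℕ) (u v : ℚ) :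
    Apoly (n + 1) m u v = ∑ w ∈ avoiders n,
      if numAscents w = m then u ^ w.getLastD 0 * v ^ w.foldr max 0 else 0 := by
  simp only [Apoly, aCount_eq_sum, Finset.sum_mul]
  rw [Finset.sum_congr rfl fun r _ => Finset.sum_comm, Finset.sum_comm]
  refine Finset.sum_congr rfl fun w hw => ?_
  obtain ⟨h1, h2, -⟩ := avoiders_invariants hw
  split_ifs with h
  · rw [Finset.sum_eq_single (w.foldr max 0), Finset.sum_eq_single (w.getLastD 0)]
    · simp [h]
    · intro s _ hs
      rw [if_neg fun h => hs h.2.2.symm, zero_mul, zero_mul]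
    · intro hs
      simp only [Finset.mem_range] at hs
      omega
    · intro r _ hr
      simp [hr.symm]
    · intro hr
      simp only [Finset.mem_range] at hr
      omega
  · simp [h]

theorem Bpoly_eq_sum (n m : ℕ) (v : ℚ) :
    Bpoly (n + 1) m v = ∑ w ∈ avoiders n,
      if numAscents w = m ∧ w.getLastD 0 = w.foldr max 0 then v ^ w.foldr max 0 else 0 := by
  simp only [Bpoly, aCount_eq_sum, Finset.sum_mul]
  rw [Finset.sum_comm]
  refine Finset.sum_congr rfl fun w hw => ?_
  obtain ⟨-, h2, -⟩ := avoiders_invariants hw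
  rw [Finset.sum_eq_single (w.foldr max 0)]
  · simp
  · intro r _ hr
    simp [hr.symm]
  · intro hr
    simp only [Finset.mem_range] at hr
    rw [if_neg (by omega), zero_mul]

/-- Deleting the final letter of the sequences that end in `0`. -/
theorem sum_getLastD_eq_zero (n m : ℕ) (v : ℚ) :
    (∑ w ∈ avoiders (n + 1),
      if numAscents w = m ∧ w.getLastD 0 = 0 then v ^ w.foldr max 0 else 0) =
      Apoly (n + 1) m 1 v := by
  rw [sum_avoiders_succ, Apoly_eq_sum]
  refine Finset.sum_congr rfl fun w hw => ?_
  rw [Finset.sum_eq_single 0]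
  · simp [numAscents_append_singleton (ne_nil_of_mem_avoiders hw)]
  · intro s _ hs
    simp [hs]
  · simp [mem_extensions]

theorem Apoly_eq_Bpoly_add (n m : ℕ) (hm : 1 ≤ m) (u v : ℚ) :
    Apoly (n + 2) m u v = Bpoly (n + 2) m (u * v) + Apoly (n + 1) m 1 v := by
  rw [← sum_getLastD_eq_zero, Apoly_eq_sum, Bpoly_eq_sum, ← Finset.sum_add_distrib]
  refine Finset.sum_congr rfl fun w hw => ?_
  obtain ⟨h1, -, h3⟩ := avoiders_invariants hw
  by_cases h : numAscents w = m
  · have hpos : w.foldr max 0 ≠ 0 := by omega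
    rcases h1 with h1 | h1
    · simp only [h, h1, hpos.symm]; simp
    · simp only [h, h1, hpos, mul_pow]; simp
  · simp [h]

theorem sum_Ioc_pow {v : ℚ} (hv : v ≠ 1) {a b : ℕ} (hab : a ≤ b) :
    ∑ s ∈ Finset.Ioc a b, v ^ s = v / (1 - v) * (v ^ a - v ^ b) := by
  have hv' : 1 - v ≠ 0 := sub_ne_zero.2 hv.symm
  induction b, hab using Nat.le_induction with
  | base => simp
  | succ b hab ih =>
    rw [Finset.sum_Ioc_succ_top (by omega), ih]
    field_simp
    ring

/-- The total weight of the extensions of `w` with final letter equal to the largest letter. -/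
theorem sum_extensions {n m : ℕ} {w : List ℕ} (hw : w ∈ avoiders n) (hm : 1 ≤ m) {v : ℚ}
    (hv : v ≠ 1) :
    (∑ s ∈ extensions w, if numAscents (w ++ [s]) = m + 1 ∧
        (w ++ [s]).getLastD 0 = (w ++ [s]).foldr max 0 then v ^ (w ++ [s]).foldr max 0 else 0) =
      (if numAscents w = m + 1 ∧ w.getLastD 0 = w.foldr max 0 then v ^ w.foldr max 0 else 0) +
      (if numAscents w = m ∧ w.getLastD 0 = 0 then v ^ w.foldr max 0 else 0) +
      (if numAscents w = m then v / (1 - v) * (v ^ w.foldr max 0 - v ^ (m + 1)) else 0) := by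
  obtain ⟨h1, h2, h3⟩ := avoiders_invariants hw
  have hl (s : ℕ) : (w ++ [s]).getLastD 0 = s := by simp
  simp only [numAscents_append_singleton (ne_nil_of_mem_avoiders hw), hl,
    foldr_max_append_singleton]
  rw [← Finset.sum_filter]
  generalize hM : w.foldr max 0 = M at *
  generalize hL : w.getLastD 0 = L at *
  generalize hA : numAscents w = A at *
  have hcongr (S : Finset ℕ) (hS : ∀ s, s ∈ S ↔ s ∈ extensions w ∧
      (A + (if L < s then 1 else 0) = m + 1 ∧ s = max M s)) :
      ∑ s ∈ (extensions w).filter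
        (fun s => A + (if L < s then 1 else 0) = m + 1 ∧ s = max M s), v ^ max M s =
      ∑ s ∈ S, v ^ s := by
    refine Finset.sum_congr (by ext s; simp [hS]) fun s hs => ?_
    rw [← ((hS s).1 hs).2.2]
  simp only [mem_extensions, hM, hA] at hcongr
  by_cases hAm : A = m
  · subst hAm
    rw [← sum_Ioc_pow hv (show M ≤ A + 1 by omega)]
    rcases h1 with h1 | h1
    · rw [hcongr (Finset.Icc M (A + 1)), ← Finset.add_sum_Ioc_eq_sum_Icc (by omega)]
      · simp [h1]
      · intro s
        simp only [Finset.mem_Icc]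
        split_ifs <;> omega
    · rw [hcongr (Finset.Ioc M (A + 1))]
      · simp [h1, show M ≠ 0 by omega]
      · intro s
        simp only [Finset.mem_Ioc]
        split_ifs <;> omega
  · by_cases hAm' : A = m + 1 ∧ L = M
    · rw [hcongr {M}]
      · simp [hAm']
      · intro s
        simp only [Finset.mem_singleton]
        split_ifs <;> omega
    · rw [hcongr ∅]
      · simp [hAm, hAm']
      · intro s
        simp only [Finset.notMem_empty, false_iff]
        split_ifs <;> omega

theorem Bpoly_succ (n m : ℕ) (hm : 1 ≤ m) {v : ℚ} (hv : v ≠ 1) :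
    Bpoly (n + 3) (m + 1) v = Bpoly (n + 2) (m + 1) v + Apoly (n + 1) m 1 v +
      v / (1 - v) * (Apoly (n + 2) m 1 v - v ^ (m + 1) * Apoly (n + 2) m 1 1) := by
  rw [← sum_getLastD_eq_zero, Bpoly_eq_sum, Bpoly_eq_sum, Apoly_eq_sum, Apoly_eq_sum,
    sum_avoiders_succ, Finset.sum_congr rfl fun w hw => sum_extensions hw hm hv,
    Finset.sum_add_distrib, Finset.sum_add_distrib, Finset.mul_sum, ← Finset.sum_sub_distrib,
    Finset.mul_sum]
  congr 1
  refine Finset.sum_congr rfl fun w _ => ?_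
  split_ifs <;> simp

/-- Recurrences for `A_{n,m}(u,v)` and `B_{n,m}(v)` for `n ≥ 3`, `2 ≤ m ≤ n-1`. -/
theorem Apoly_Bpoly_rec (n m : ℕ) (hn : 3 ≤ n) (hm1 : 2 ≤ m) (hm2 : m ≤ n - 1) (u v : ℚ) :
    (u * v ≠ 1 →
      Apoly n m u v = Bpoly (n - 1) m (u * v) + Apoly (n - 1) m 1 v +
        Apoly (n - 2) (m - 1) 1 (u * v) +
        (u * v / (1 - u * v)) *
          (Apoly (n - 1) (m - 1) 1 (u * v) - (u * v) ^ m * Apoly (n - 1) (m - 1) 1 1)) ∧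
    (v ≠ 1 →
      Bpoly n m v = Bpoly (n - 1) m v + Apoly (n - 2) (m - 1) 1 v +
        (v / (1 - v)) *
          (Apoly (n - 1) (m - 1) 1 v - v ^ m * Apoly (n - 1) (m - 1) 1 1)) := by
  obtain ⟨k, rfl⟩ : ∃ k, n = k + 3 := ⟨n - 3, by omega⟩
  obtain ⟨j, rfl⟩ : ∃ j, m = j + 1 := ⟨m - 1, by omega⟩
  have hj : 1 ≤ j := by omega
  refine ⟨fun h => ?_, fun h => Bpoly_succ k j hj h⟩
  have hA : Apoly (k + 3) (j + 1) u v =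
      Bpoly (k + 3) (j + 1) (u * v) + Apoly (k + 2) (j + 1) 1 v :=
    Apoly_eq_Bpoly_add (k + 1) (j + 1) (by omega) u v
  rw [hA, Bpoly_succ k j hj h]
  simp only [Nat.add_sub_cancel, show k + 3 - 1 = k + 2 from rfl, show k + 3 - 2 = k + 1 from rfl]
  ring
end
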